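/- For every Petri net N = (P, T, m0) there exists a concurrent asynchronous QDAS A_N over the domain {0,1}, with a single concurrent queue, whose blocks include a block named p for every place p in P (with initial state s0_p and state set S_p), together with two designated states t1 and t2 of two further blocks, such that, defining a CTG G to encode a marking m iff Parikh(G)(t1) = Parikh(G)(t2) = 1, Parikh(G)(s0_p) = m(p) for every p in P, and Parikh(G)(s) = 0 for every p in P and every s in S_p other than s0_p, the following holds: a marking m belongs to Cover(N) if and only if there exists (G,d) in Reach(A_N) such that G encodes m. -/

import Mathlib

open scoped Classical

/-! ### Generic labeled runs -/

/-- A run `c0 = cs 0, ls 0, cs 1, ls 1, …, cs n` of a labeled transition relation. -/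
def IsRun {C L : Type} (step : C → L → C → Prop) (c0 : C) (n : ℕ)
    (cs : ℕ → C) (ls : ℕ → L) : Prop :=
  cs 0 = c0 ∧ ∀ i < n, step (cs i) (ls i) (cs (i + 1))

/-! ### Guards over variables `X` ranging over a finite domain `D`.
A guard is a finite conjunction of atoms `x = d` (flag `true`) and `x ≠ d` (flag `false`). -/

def GuardSat {X D : Type} (d : X → D) (g : List (X × D × Bool)) : Prop :=
  ∀ a ∈ g, if a.2.2 then d a.1 = a.2.1 else d a.1 ≠ a.2.1

/-! ### QDAS actions -/

inductive QAct (Q Γ X D : Type) : Type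
  | dispatchA (q : Q) (γ : Γ)
  | dispatchS (q : Q) (γ : Γ)
  | guard (g : List (X × D × Bool))
  | assign (x : X) (d : D)

/-! ### Call-task graphs -/

/-- A call-task graph over queue identifiers `Q`, blocks `Γ` and states `S`.
Vertices are natural numbers; the graph consists of the finite set `verts`.
`task v` tells whether `v` is a task vertex (otherwise it is a call vertex),
`qEdge`/`wEdge` are the queue resp. wait edges, `lab` is the labeling by blocks,
`queueOf v = some q` records the queue of `v` (`none` is the dummy symbol ι),
and `st` is the labeling by states. -/
structure CTG (Q Γ S : Type) : Type where
  verts : Finset ℕ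
  task : ℕ → Prop
  qEdge : ℕ → ℕ → Prop
  wEdge : ℕ → ℕ → Prop
  lab : ℕ → Γ
  queueOf : ℕ → Option Q
  st : ℕ → S

namespace CTG

variable {Q Γ S : Type}

def edge (G : CTG Q Γ S) (a b : ℕ) : Prop := G.qEdge a b ∨ G.wEdge a b

/-- A vertex is unblocked iff it is in the graph and has no outgoing edge. -/
def Unblocked (G : CTG Q Γ S) (v : ℕ) : Prop := v ∈ G.verts ∧ ∀ b, ¬ G.edge v b

/-- The most recently enqueued call vertex of `q`: a call vertex of `q`
with no incoming queue edge. -/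
def IsTail (G : CTG Q Γ S) (q : Q) (b : ℕ) : Prop :=
  b ∈ G.verts ∧ ¬ G.task b ∧ G.queueOf b = some q ∧ ∀ a, ¬ G.qEdge a b

/-- The head of `q`: a call vertex of `q` with no outgoing queue edge. -/
def IsHead (G : CTG Q Γ S) (q : Q) (v : ℕ) : Prop :=
  v ∈ G.verts ∧ ¬ G.task v ∧ G.queueOf v = some q ∧ ∀ b, ¬ G.qEdge v b

/-- Update the state of vertex `v` to `s`. -/
def setSt (G : CTG Q Γ S) (v : ℕ) (s : S) : CTG Q Γ S :=
  { G with st := Function.update G.st v s }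

/-- Add a wait edge from `a` to `b`. -/
def addWait (G : CTG Q Γ S) (a b : ℕ) : CTG Q Γ S :=
  { G with wEdge := fun x y => G.wEdge x y ∨ (x = a ∧ y = b) }

/-- Enqueue a fresh call vertex `v'` for block `γ` (with initial state `s0`) into
queue `q`: a queue edge from `v'` to the most recently enqueued call vertex of `q`
(if any) is added, and, if `q` is serial and a task vertex of `q` is present,
a wait edge from `v'` to it. -/
def enqueue (G : CTG Q Γ S) (serialq : Prop) (q : Q) (γ : Γ) (s0 : S) (v' : ℕ) :
    CTG Q Γ S where
  verts := insert v' G.verts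
  task := fun u => u ≠ v' ∧ G.task u
  qEdge := fun a b => G.qEdge a b ∨ (a = v' ∧ G.IsTail q b)
  wEdge := fun a b =>
    G.wEdge a b ∨ (serialq ∧ a = v' ∧ b ∈ G.verts ∧ G.task b ∧ G.queueOf b = some q)
  lab := Function.update G.lab v' γ
  queueOf := Function.update G.queueOf v' (some q)
  st := Function.update G.st v' s0

/-- Dequeue the head `v` of its queue: `v` becomes a task vertex, its incident
queue edges disappear, and if the queue is serial a wait edge is added from the new
head of the queue (the call vertex with a queue edge to `v`, if any) to `v`. -/
def dequeue (G : CTG Q Γ S) (serialq : Prop) (v : ℕ) : CTG Q Γ S :=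
  { G with
    task := fun u => u = v ∨ G.task u
    qEdge := fun a b => G.qEdge a b ∧ a ≠ v ∧ b ≠ v
    wEdge := fun a b => G.wEdge a b ∨ (serialq ∧ b = v ∧ G.qEdge a v) }

/-- Remove vertex `v` together with its incident edges. -/
def erase (G : CTG Q Γ S) (v : ℕ) : CTG Q Γ S :=
  { G with
    verts := G.verts.erase v
    qEdge := fun a b => G.qEdge a b ∧ a ≠ v ∧ b ≠ v
    wEdge := fun a b => G.wEdge a b ∧ a ≠ v ∧ b ≠ v }

/-- The Parikh image of a CTG: the number of vertices in state `s`. -/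
noncomputable def parikh (G : CTG Q Γ S) (s : S) : ℕ :=
  (G.verts.filter fun v => G.st v = s).card

/-- `G` is encoded by the word `u = u₀u₁⋯uₙ` over `S` iff `G` consists of vertices
`v₀,…,vₙ` forming a single path of wait edges with `st vᵢ = uᵢ` (and no queue edges);
the empty CTG is encoded by the empty word. -/
def EncodedBy (G : CTG Q Γ S) (u : List S) : Prop :=
  ∃ vs : List ℕ, vs.Nodup ∧ vs.toFinset = G.verts ∧ vs.map G.st = u ∧
    (∀ a b, G.wEdge a b ↔ (a, b) ∈ vs.zip vs.tail) ∧ ∀ a b, ¬ G.qEdge a b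

end CTG

/-! ### Queue-dispatch asynchronous systems -/

/-- A QDAS over queue ids `Q` (serial ones are those satisfying `serial`),
blocks `Γ` with initial block `main`, variables `X` over domain `D` with initial
value `d0`, and states `S`, partitioned among the blocks by `blockOf`, each block
`γ` having initial state `init γ` and final state `final γ`. -/
structure QDAS (Q Γ X D S : Type) : Type where
  serial : Q → Prop
  main : Γ
  d0 : D
  blockOf : S → Γ
  init : Γ → S
  final : Γ → S
  init_block : ∀ γ, blockOf (init γ) = γ
  final_block : ∀ γ, blockOf (final γ) = γ
  rules : Set (S × QAct Q Γ X D × S)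
  rules_fin : rules.Finite
  rules_block : ∀ r ∈ rules, blockOf r.1 = blockOf r.2.2
  rules_not_main : ∀ r ∈ rules, ∀ q γ,
    (r.2.1 = QAct.dispatchA q γ ∨ r.2.1 = QAct.dispatchS q γ) → γ ≠ main

/-- A configuration of a QDAS: a call-task graph together with a valuation. -/
abbrev QConfig (Q Γ X D S : Type) : Type := CTG Q Γ S × (X → D)

namespace QDAS

variable {Q Γ X D S : Type}

/-- The initial CTG: a single task vertex running `main`. -/
def initCTG (A : QDAS Q Γ X D S) : CTG Q Γ S where
  verts := {0}
  task := fun v => v = 0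
  qEdge := fun _ _ => False
  wEdge := fun _ _ => False
  lab := fun _ => A.main
  queueOf := fun _ => none
  st := fun _ => A.init A.main

def initConfig (A : QDAS Q Γ X D S) : QConfig Q Γ X D S := (A.initCTG, fun _ => A.d0)

/-- The labeled transition relation of a QDAS (`none` is the scheduler label ε). -/
inductive Step (A : QDAS Q Γ X D S) :
    QConfig Q Γ X D S → Option (QAct Q Γ X D) → QConfig Q Γ X D S → Prop
  | guard {G : CTG Q Γ S} {d : X → D} {v : ℕ} {g : List (X × D × Bool)} {s' : S} :
      G.task v → G.Unblocked v → (G.st v, QAct.guard g, s') ∈ A.rules → GuardSat d g →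
      Step A (G, d) (some (QAct.guard g)) (G.setSt v s', d)
  | assign {G : CTG Q Γ S} {d : X → D} {v : ℕ} {x : X} {dd : D} {s' : S} :
      G.task v → G.Unblocked v → (G.st v, QAct.assign x dd, s') ∈ A.rules →
      Step A (G, d) (some (QAct.assign x dd)) (G.setSt v s', Function.update d x dd)
  | dispatchA {G : CTG Q Γ S} {d : X → D} {v : ℕ} {q : Q} {γ : Γ} {s' : S} {v' : ℕ} :
      G.task v → G.Unblocked v → (G.st v, QAct.dispatchA q γ, s') ∈ A.rules →
      v' ∉ G.verts →
      Step A (G, d) (some (QAct.dispatchA q γ))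
        ((G.setSt v s').enqueue (A.serial q) q γ (A.init γ) v', d)
  | dispatchS {G : CTG Q Γ S} {d : X → D} {v : ℕ} {q : Q} {γ : Γ} {s' : S} {v' : ℕ} :
      G.task v → G.Unblocked v → (G.st v, QAct.dispatchS q γ, s') ∈ A.rules →
      v' ∉ G.verts →
      Step A (G, d) (some (QAct.dispatchS q γ))
        (((G.setSt v s').enqueue (A.serial q) q γ (A.init γ) v').addWait v v', d)
  | schedErase {G : CTG Q Γ S} {d : X → D} {v : ℕ} :
      G.task v → G.Unblocked v → G.st v = A.final (G.lab v) →
      Step A (G, d) none (G.erase v, d)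
  | schedDequeue {G : CTG Q Γ S} {d : X → D} {q : Q} {v : ℕ} :
      G.IsHead q v → (∀ b, ¬ G.edge v b) →
      Step A (G, d) none (G.dequeue (A.serial q) v, d)

/-- Reachable configurations. -/
def Reach (A : QDAS Q Γ X D S) : Set (QConfig Q Γ X D S) :=
  { c | Relation.ReflTransGen (fun c1 c2 => ∃ a, A.Step c1 a c2) A.initConfig c }

/-- `f` is Parikh-coverable in `A` iff some reachable configuration covers it. -/
def ParikhCoverable (A : QDAS Q Γ X D S) (f : S → ℕ) : Prop :=
  ∃ c ∈ A.Reach, ∀ s, f s ≤ c.1.parikh s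

/-- A QDAS is synchronous iff no rule carries an asynchronous dispatch. -/
def Synchronous (A : QDAS Q Γ X D S) : Prop :=
  ∀ r ∈ A.rules, ∀ q γ, r.2.1 ≠ QAct.dispatchA q γ

/-- A QDAS is asynchronous iff no rule carries a synchronous dispatch. -/
def Asynchronous (A : QDAS Q Γ X D S) : Prop :=
  ∀ r ∈ A.rules, ∀ q γ, r.2.1 ≠ QAct.dispatchS q γ

/-- A QDAS terminates iff it admits no infinite run. -/
def Terminates (A : QDAS Q Γ X D S) : Prop :=
  ¬ ∃ cs : ℕ → QConfig Q Γ X D S,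
      cs 0 = A.initConfig ∧ ∀ i, ∃ a, A.Step (cs i) a (cs (i + 1))

end QDAS

/-! ### Pushdown systems (without data) -/

inductive PAct (Φ : Type) : Type
  | push (φ : Φ)
  | pop (φ : Φ)
  | internal (n : ℕ)

structure PDS (Y Φ : Type) : Type where
  y0 : Y
  rules : Set (Y × PAct Φ × Y)
  rules_fin : rules.Finite

namespace PDS

variable {Y Φ : Type}

inductive Step (P : PDS Y Φ) : Y × List Φ → PAct Φ → Y × List Φ → Prop
  | push {y y' : Y} {φ : Φ} {w : List Φ} :
      (y, PAct.push φ, y') ∈ P.rules → Step P (y, w) (PAct.push φ) (y', w ++ [φ])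
  | pop {y y' : Y} {φ : Φ} {w : List Φ} :
      (y, PAct.pop φ, y') ∈ P.rules → Step P (y, w ++ [φ]) (PAct.pop φ) (y', w)
  | internal {y y' : Y} {n : ℕ} {w : List Φ} :
      (y, PAct.internal n, y') ∈ P.rules → Step P (y, w) (PAct.internal n) (y', w)

def initConfig (P : PDS Y Φ) : Y × List Φ := (P.y0, [])

def Reachable (P : PDS Y Φ) (c : Y × List Φ) : Prop :=
  Relation.ReflTransGen (fun a b => ∃ l, P.Step a l b) P.initConfig c

end PDS

/-! ### Pushdown systems with data -/

inductive PDAct (Φ X D : Type) : Type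
  | push (φ : Φ)
  | pop (φ : Φ)
  | guard (g : List (X × D × Bool))
  | assign (x : X) (d : D)
  | internal (n : ℕ)

structure PDSD (Y Φ X D : Type) : Type where
  y0 : Y
  d0 : D
  rules : Set (Y × PDAct Φ X D × Y)
  rules_fin : rules.Finite

namespace PDSD

variable {Y Φ X D : Type}

inductive Step (P : PDSD Y Φ X D) :
    Y × List Φ × (X → D) → PDAct Φ X D → Y × List Φ × (X → D) → Prop
  | push {y y' : Y} {φ : Φ} {w : List Φ} {d : X → D} :
      (y, PDAct.push φ, y') ∈ P.rules →
      Step P (y, w, d) (PDAct.push φ) (y', w ++ [φ], d)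
  | pop {y y' : Y} {φ : Φ} {w : List Φ} {d : X → D} :
      (y, PDAct.pop φ, y') ∈ P.rules →
      Step P (y, w ++ [φ], d) (PDAct.pop φ) (y', w, d)
  | guard {y y' : Y} {g : List (X × D × Bool)} {w : List Φ} {d : X → D} :
      (y, PDAct.guard g, y') ∈ P.rules → GuardSat d g →
      Step P (y, w, d) (PDAct.guard g) (y', w, d)
  | assign {y y' : Y} {x : X} {dd : D} {w : List Φ} {d : X → D} :
      (y, PDAct.assign x dd, y') ∈ P.rules →
      Step P (y, w, d) (PDAct.assign x dd) (y', w, Function.update d x dd)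
  | internal {y y' : Y} {n : ℕ} {w : List Φ} {d : X → D} :
      (y, PDAct.internal n, y') ∈ P.rules →
      Step P (y, w, d) (PDAct.internal n) (y', w, d)

def initConfig (P : PDSD Y Φ X D) : Y × List Φ × (X → D) := (P.y0, [], fun _ => P.d0)

def Reachable (P : PDSD Y Φ X D) (c : Y × List Φ × (X → D)) : Prop :=
  Relation.ReflTransGen (fun a b => ∃ l, P.Step a l b) P.initConfig c

end PDSD

/-! ### Petri nets -/

/-- A Petri net over places `P`: transitions are pairs of `{0,1}`-valued input and
output functions (represented as `P → Bool`). -/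
structure PetriNet (P : Type) : Type where
  trans : Set ((P → Bool) × (P → Bool))
  trans_fin : trans.Finite
  m0 : P → ℕ

namespace PetriNet

variable {P : Type}

def inp (t : (P → Bool) × (P → Bool)) (p : P) : ℕ := if t.1 p then 1 else 0
def out (t : (P → Bool) × (P → Bool)) (p : P) : ℕ := if t.2 p then 1 else 0

def FiresVia (N : PetriNet P) (t : (P → Bool) × (P → Bool)) (m m' : P → ℕ) : Prop :=
  t ∈ N.trans ∧ (∀ p, inp t p ≤ m p) ∧ ∀ p, m' p = m p - inp t p + out t p

def Fires (N : PetriNet P) (m m' : P → ℕ) : Prop := ∃ t, N.FiresVia t m m'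

def Reach (N : PetriNet P) : Set (P → ℕ) :=
  { m | Relation.ReflTransGen N.Fires N.m0 m }

def Cover (N : PetriNet P) : Set (P → ℕ) := { m | ∃ m' ∈ N.Reach, m ≤ m' }

/-- A Petri net terminates iff it admits no infinite run. -/
def Terminates (N : PetriNet P) : Prop :=
  ¬ ∃ ms : ℕ → (P → ℕ), ms 0 = N.m0 ∧ ∀ i, N.Fires (ms i) (ms (i + 1))

end PetriNet

/-! ### Parikh images along transitions -/

namespace CTG

variable {Q Γ S : Type}

theorem parikh_eq_sum (G : CTG Q Γ S) (s : S) :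
    G.parikh s = ∑ v ∈ G.verts, if G.st v = s then 1 else 0 :=
  Finset.card_filter _ _

theorem parikh_setSt (G : CTG Q Γ S) {v : ℕ} (hv : v ∈ G.verts) (s' s : S) :
    (G.setSt v s').parikh s + (if G.st v = s then 1 else 0)
      = G.parikh s + (if s' = s then 1 else 0) := by
  rw [parikh_eq_sum, parikh_eq_sum]
  change (∑ u ∈ G.verts, if Function.update G.st v s' u = s then 1 else 0) + _ = _
  rw [← Finset.add_sum_erase _ _ hv,
    ← Finset.add_sum_erase G.verts (fun u => if G.st u = s then 1 else 0) hv]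
  have h : ∑ u ∈ G.verts.erase v, (if Function.update G.st v s' u = s then 1 else 0)
      = ∑ u ∈ G.verts.erase v, (if G.st u = s then 1 else 0) :=
    Finset.sum_congr rfl fun u hu => by
      rw [Function.update_of_ne (Finset.ne_of_mem_erase hu)]
  rw [h, Function.update_self]
  omega

theorem parikh_enqueue (G : CTG Q Γ S) {v' : ℕ} (hv' : v' ∉ G.verts) (ser : Prop) (q : Q)
    (γ : Γ) (s0 s : S) :
    (G.enqueue ser q γ s0 v').parikh s = G.parikh s + (if s0 = s then 1 else 0) := by
  rw [parikh_eq_sum, parikh_eq_sum]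
  change (∑ u ∈ insert v' G.verts, if Function.update G.st v' s0 u = s then 1 else 0) = _
  rw [Finset.sum_insert hv', Function.update_self, add_comm]
  congr 1
  refine Finset.sum_congr rfl fun u hu => ?_
  rw [Function.update_of_ne (ne_of_mem_of_not_mem hu hv')]

theorem parikh_erase (G : CTG Q Γ S) {v : ℕ} (hv : v ∈ G.verts) (s : S) :
    (G.erase v).parikh s + (if G.st v = s then 1 else 0) = G.parikh s := by
  rw [parikh_eq_sum, parikh_eq_sum]
  exact Finset.sum_erase_add G.verts (fun u => if G.st u = s then 1 else 0) hv

theorem parikh_dequeue (G : CTG Q Γ S) (ser : Prop) (v : ℕ) (s : S) :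
    (G.dequeue ser v).parikh s = G.parikh s := rfl

theorem exists_of_parikh_pos (G : CTG Q Γ S) {s : S} (h : 0 < G.parikh s) :
    ∃ v ∈ G.verts, G.st v = s := by
  obtain ⟨v, hv⟩ := Finset.card_pos.mp h
  exact ⟨v, Finset.mem_filter.mp hv⟩

end CTG

/-! ### The QDAS simulating a Petri net

The main task keeps a set `I` of places whose flag it must still reset and the numbers `O` of
tokens it must still dispatch. A token of `p` is a vertex of block `p` in its initial state; at
any time it may disappear while raising the flag of `p`. A transition is started once the flags
of all its input places are raised. The block `none : Option P` is a companion block that is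
dispatched exactly once. -/

/-- States of the simulating QDAS, with at most `B` pending dispatches per block. -/
inductive SimState (P : Type) (B : ℕ) : Type
  | run (I : P → Bool) (O : Option P → Fin (B + 1))
  | halt
  | tok (o : Option P)
  | fin (o : Option P)

namespace SimState

variable {P : Type} {B : ℕ}

theorem finite [Finite P] : Finite (SimState P B) := by
  let f : ((P → Bool) × (Option P → Fin (B + 1))) ⊕ Unit ⊕ Option P ⊕ Option P → SimState P B
    | .inl x => run x.1 x.2
    | .inr (.inl _) => halt
    | .inr (.inr (.inl o)) => tok o
    | .inr (.inr (.inr o)) => fin o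
  refine Finite.of_surjective f fun s => ?_
  cases s with
  | run I O => exact ⟨.inl (I, O), rfl⟩
  | halt => exact ⟨.inr (.inl ()), rfl⟩
  | tok o => exact ⟨.inr (.inr (.inl o)), rfl⟩
  | fin o => exact ⟨.inr (.inr (.inr o)), rfl⟩

/-- The block of a state; `none` is the main block. -/
def block : SimState P B → Option (Option P)
  | run _ _ => none
  | halt => none
  | tok o => some o
  | fin o => some o

end SimState

namespace PetriNet

open SimState

variable {P : Type} [Fintype P]

/-- A bound on the number of tokens of one place the main task ever has to dispatch in a row. -/
def bound (N : PetriNet P) : ℕ := ∑ p, N.m0 p + 1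

/-- Pending dispatches: `k` times the companion block, and `f p` times the block of `p`. -/
def pending (N : PetriNet P) (k : ℕ) (f : P → ℕ) (o : Option P) : Fin (N.bound + 1) :=
  Fin.ofNat _ (o.elim k f)

theorem pending_val (N : PetriNet P) {k : ℕ} {f : P → ℕ} (hk : k ≤ 1)
    (hf : ∀ p, f p ≤ N.bound) (o : Option P) : (N.pending k f o : ℕ) = o.elim k f := by
  refine Nat.mod_eq_of_lt (Nat.lt_succ_of_le ?_)
  cases o with
  | none => exact hk.trans (Nat.le_add_left _ _)
  | some p => exact hf p

theorem m0_le_bound (N : PetriNet P) (p : P) : N.m0 p ≤ N.bound :=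
  (Finset.single_le_sum (f := N.m0) (fun _ _ => Nat.zero_le _) (Finset.mem_univ p)).trans
    (Nat.le_succ _)

theorem out_le_bound (N : PetriNet P) (t : (P → Bool) × (P → Bool)) (p : P) :
    out t p ≤ N.bound := by
  unfold out bound
  split <;> omega

/-- The guard requiring all flags of the places in `I` to be raised. -/
noncomputable def inputGuard (I : P → Bool) : List (P × Bool × Bool) :=
  (Finset.univ.filter fun p => I p = true).toList.map fun p => (p, true, true)

theorem guardSat_inputGuard {d : P → Bool} {I : P → Bool} :
    GuardSat d (inputGuard I) ↔ ∀ p, I p = true → d p = true := by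
  simp [GuardSat, inputGuard]

/-- Decrease one entry of the vector of pending dispatches. -/
noncomputable def dec {B : ℕ} (O : Option P → Fin (B + 1)) (o : Option P) :
    Option P → Fin (B + 1) :=
  Function.update O o ⟨O o - 1, by omega⟩

/-- The rules of the simulating QDAS. -/
inductive SimRule (N : PetriNet P) : SimState P N.bound →
    QAct Unit (Option (Option P)) P Bool → SimState P N.bound → Prop
  | start (t : (P → Bool) × (P → Bool)) (ht : t ∈ N.trans) :
      SimRule N (run (fun _ => false) fun _ => 0) (QAct.guard (inputGuard t.1))
        (run t.1 (N.pending 0 (out t)))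
  | clear (I : P → Bool) (O : Option P → Fin (N.bound + 1)) (p : P) :
      SimRule N (run I O) (QAct.assign p false) (run (Function.update I p false) O)
  | emit (I : P → Bool) (O : Option P → Fin (N.bound + 1)) (o : Option P)
      (ho : 0 < (O o : ℕ)) :
      SimRule N (run I O) (QAct.dispatchA () (some o)) (run I (dec O o))
  | consume (p : P) : SimRule N (tok (some p)) (QAct.assign p true) (fin (some p))

theorem simRule_finite (N : PetriNet P) :
    {r : SimState P N.bound × QAct Unit (Option (Option P)) P Bool × SimState P N.bound |
      SimRule N r.1 r.2.1 r.2.2}.Finite := by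
  have := SimState.finite (P := P) (B := N.bound)
  let acts : Set (QAct Unit (Option (Option P)) P Bool) :=
    ((fun t => QAct.guard (inputGuard t.1)) '' N.trans) ∪
      (Set.range fun x : P × Bool => QAct.assign x.1 x.2) ∪
      Set.range fun o => QAct.dispatchA () (some o)
  have hacts : acts.Finite :=
    ((N.trans_fin.image _).union (Set.finite_range _)).union (Set.finite_range _)
  refine (Set.finite_univ.prod (hacts.prod Set.finite_univ)).subset ?_
  rintro ⟨s, a, s'⟩ h
  refine ⟨trivial, ?_, trivial⟩
  cases h with
  | start t ht => exact Or.inl (Or.inl ⟨t, ht, rfl⟩)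
  | clear I O p => exact Or.inl (Or.inr ⟨(p, false), rfl⟩)
  | emit I O o ho => exact Or.inr ⟨o, rfl⟩
  | consume p => exact Or.inl (Or.inr ⟨(p, true), rfl⟩)

/-- The concurrent asynchronous QDAS simulating `N`. -/
noncomputable def toQDAS (N : PetriNet P) :
    QDAS Unit (Option (Option P)) P Bool (SimState P N.bound) where
  serial := fun _ => False
  main := none
  d0 := false
  blockOf := block
  init := fun γ => γ.elim (run (fun _ => false) (N.pending 1 N.m0)) tok
  final := fun γ => γ.elim halt fin
  init_block := by rintro (_ | o) <;> rfl
  final_block := by rintro (_ | o) <;> rfl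
  rules := {r | SimRule N r.1 r.2.1 r.2.2}
  rules_fin := N.simRule_finite
  rules_block := by
    rintro ⟨s, a, s'⟩ h
    cases h <;> rfl
  rules_not_main := by
    rintro ⟨s, a, s'⟩ h q γ hγ
    cases h <;> simp_all
    simp [← hγ]

theorem toQDAS_final_ne_run (N : PetriNet P) (γ : Option (Option P)) (I : P → Bool)
    (O : Option P → Fin (N.bound + 1)) : N.toQDAS.final γ ≠ run I O := by
  rcases γ with _ | o <;> simp [toQDAS]

theorem toQDAS_asynchronous (N : PetriNet P) : N.toQDAS.Asynchronous := by
  rintro ⟨s, a, s'⟩ h q γ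
  cases h <;> simp

/-! ### Soundness -/

/-- The invariant of all reachable configurations: tokens, raised flags that are not about to be
reset, and pending dispatches are together covered by a reachable marking. -/
def SimInv (N : PetriNet P) (G : CTG Unit (Option (Option P)) (SimState P N.bound))
    (d : P → Bool) : Prop :=
  ∃ I O, 0 ∈ G.verts ∧ G.st 0 = run I O ∧
    (∀ v ∈ G.verts, v ≠ 0 → ∃ o, G.st v = tok o ∨ G.st v = fin o) ∧
    ∃ m ∈ N.Reach, ∀ p,
      G.parikh (tok (some p)) + (if d p = true ∧ I p = false then 1 else 0) + O (some p) ≤ m p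

variable {N : PetriNet P}

theorem simInv_init : SimInv N N.toQDAS.initCTG fun _ => N.toQDAS.d0 := by
  refine ⟨fun _ => false, N.pending 1 N.m0, by simp [QDAS.initCTG], rfl, ?_, N.m0,
    Relation.ReflTransGen.refl, fun p => ?_⟩
  · intro v hv h0
    simp [QDAS.initCTG] at hv
    exact absurd hv h0
  · rw [pending_val N le_rfl N.m0_le_bound]
    simp [CTG.parikh, QDAS.initCTG, toQDAS]

theorem SimInv.eq_zero {G : CTG Unit (Option (Option P)) (SimState P N.bound)} {d : P → Bool}
    (h : SimInv N G d) {v : ℕ} (hv : v ∈ G.verts) {I : P → Bool}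
    {O : Option P → Fin (N.bound + 1)} (hst : G.st v = run I O) : v = 0 := by
  obtain ⟨_, _, _, _, hoth, _⟩ := h
  by_contra h0
  obtain ⟨o, ho⟩ := hoth v hv h0
  simp [hst] at ho

theorem other_setSt_zero {G : CTG Unit (Option (Option P)) (SimState P N.bound)}
    (h : ∀ v ∈ G.verts, v ≠ 0 → ∃ o, G.st v = tok o ∨ G.st v = fin o) (s : SimState P N.bound) :
    ∀ v ∈ (G.setSt 0 s).verts, v ≠ 0 →
      ∃ o, (G.setSt 0 s).st v = tok o ∨ (G.setSt 0 s).st v = fin o := fun v hv h0 => by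
  simpa [CTG.setSt, Function.update_of_ne h0] using h v hv h0

theorem SimInv.step {c c' : QConfig Unit (Option (Option P)) P Bool (SimState P N.bound)}
    {a : Option (QAct Unit (Option (Option P)) P Bool)} (h : SimInv N c.1 c.2)
    (hs : N.toQDAS.Step c a c') : SimInv N c'.1 c'.2 := by
  cases hs with
  | @guard G d v g s' ht hu hr hg =>
    change SimInv N G d at h
    change SimRule N (G.st v) (QAct.guard g) s' at hr
    generalize hst : G.st v = s at hr
    cases hr with
    | start t htr =>
      obtain rfl := h.eq_zero hu.1 hst
      obtain ⟨I, O, h0, hst0, hoth, m, hm, hle⟩ := h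
      obtain ⟨rfl, rfl⟩ : I = (fun _ => false) ∧ O = fun _ => 0 := by
        simpa using hst0.symm.trans hst
      have hd := guardSat_inputGuard.mp hg
      have hinp : ∀ p, inp t p ≤ m p ∧
          (if d p = true ∧ t.1 p = false then 1 else 0) + inp t p
            ≤ if d p = true then 1 else 0 := by
        intro p
        have h1 := hle p
        have h2 := hd p
        unfold inp
        cases hd' : d p <;> cases ht' : t.1 p <;> simp_all
        omega
      refine ⟨t.1, N.pending 0 (out t), h0, by simp [CTG.setSt], other_setSt_zero hoth _,
        fun p => m p - inp t p + out t p,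
        hm.tail ⟨t, htr, fun p => (hinp p).1, fun _ => rfl⟩, fun p => ?_⟩
      have h1 := hle p
      have h2 := hinp p
      have h3 := G.parikh_setSt h0 (run t.1 (N.pending 0 (out t))) (tok (some p))
      rw [hst] at h3
      rw [pending_val N zero_le_one (N.out_le_bound t)]
      simp at h1 h3 ⊢
      omega
  | @assign G d v p dd s' ht hu hr =>
    change SimInv N G d at h
    change SimRule N (G.st v) (QAct.assign p dd) s' at hr
    generalize hst : G.st v = s at hr
    cases hr with
    | clear I O =>
      obtain rfl := h.eq_zero hu.1 hst
      obtain ⟨I', O', h0, hst0, hoth, m, hm, hle⟩ := h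
      obtain ⟨rfl, rfl⟩ : I' = I ∧ O' = O := by simpa using hst0.symm.trans hst
      refine ⟨Function.update I' p false, O', h0, by simp [CTG.setSt],
        other_setSt_zero hoth _, m, hm, fun p' => ?_⟩
      have h1 := hle p'
      have h3 := G.parikh_setSt h0 (run (Function.update I' p false) O') (tok (some p'))
      rw [hst] at h3
      simp only [reduceCtorEq, if_false, add_zero] at h3
      rw [h3]
      by_cases hp : p' = p
      · subst hp
        simp
        omega
      · simpa [Function.update_of_ne hp] using h1
    | consume =>
      obtain ⟨I, O, h0, hst0, hoth, m, hm, hle⟩ := h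
      have hv0 : v ≠ 0 := by
        rintro rfl
        simp [hst] at hst0
      refine ⟨I, O, h0, (Function.update_of_ne hv0.symm _ _).trans hst0, fun u hu' hu0 => ?_,
        m, hm, fun p' => ?_⟩
      · by_cases huv : u = v
        · exact ⟨some p, Or.inr (by simp [CTG.setSt, huv])⟩
        · simpa [CTG.setSt, Function.update_of_ne huv] using hoth u hu' hu0
      · have h1 := hle p'
        have h3 := G.parikh_setSt hu.1 (fin (some p)) (tok (some p'))
        rw [hst] at h3
        simp only [reduceCtorEq, if_false, add_zero, tok.injEq, Option.some.injEq] at h3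
        by_cases hp : p' = p
        · subst hp
          simp only [if_true] at h3
          simp only [Function.update_self, true_and]
          have : (if I p' = false then 1 else 0) ≤ 1 := by split <;> omega
          omega
        · simp only [Function.update_of_ne hp]
          rw [if_neg (Ne.symm hp)] at h3
          omega
  | @dispatchA G d v q γ s' v' ht hu hr hv' =>
    change SimInv N G d at h
    change SimRule N (G.st v) (QAct.dispatchA q γ) s' at hr
    generalize hst : G.st v = s at hr
    cases hr with
    | emit I O o ho =>
      obtain rfl := h.eq_zero hu.1 hst
      obtain ⟨I', O', h0, hst0, hoth, m, hm, hle⟩ := h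
      obtain ⟨rfl, rfl⟩ : I' = I ∧ O' = O := by simpa using hst0.symm.trans hst
      have hne : (0 : ℕ) ≠ v' := ne_of_mem_of_not_mem h0 hv'
      refine ⟨I', dec O' o, Finset.mem_insert_of_mem h0, ?_, fun u hu' hu0 => ?_,
        m, hm, fun p => ?_⟩
      · simp [CTG.enqueue, CTG.setSt, Function.update_of_ne hne]
      · by_cases huv : u = v'
        · exact ⟨o, Or.inl (by simp [CTG.enqueue, huv, toQDAS])⟩
        · simpa [CTG.enqueue, CTG.setSt, Function.update_of_ne huv, Function.update_of_ne hu0]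
            using hoth u ((Finset.mem_insert.mp hu').resolve_left huv) hu0
      · have h1 := hle p
        have h3 := G.parikh_setSt h0 (run I' (dec O' o)) (tok (some p))
        rw [hst] at h3
        simp only [reduceCtorEq, if_false, add_zero] at h3
        rw [CTG.parikh_enqueue _ (by exact hv'), h3]
        by_cases hp : some p = o
        · subst hp
          simp [toQDAS, dec]
          omega
        · simpa [toQDAS, dec, Function.update_of_ne hp, Ne.symm hp] using h1
  | @dispatchS G d v q γ s' v' ht hu hr hv' =>
    exact absurd rfl (N.toQDAS_asynchronous _ hr q γ)
  | @schedErase G d v ht hu hf =>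
    obtain ⟨I, O, h0, hst0, hoth, m, hm, hle⟩ := h
    have hv0 : (0 : ℕ) ≠ v := by
      rintro rfl
      exact N.toQDAS_final_ne_run _ I O (hf.symm.trans hst0)
    refine ⟨I, O, Finset.mem_erase.mpr ⟨hv0, h0⟩, hst0,
      fun u hu' => hoth u (Finset.mem_of_mem_erase hu'), m, hm, fun p => ?_⟩
    have h3 := G.parikh_erase hu.1 (tok (some p))
    have h1 := hle p
    dsimp only at h1 ⊢
    omega
  | @schedDequeue G d q v hh he =>
    exact h

theorem simInv_of_reach {c : QConfig Unit (Option (Option P)) P Bool (SimState P N.bound)}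
    (h : c ∈ N.toQDAS.Reach) : SimInv N c.1 c.2 := by
  induction h with
  | refl => exact simInv_init
  | tail _ hs ih => exact ih.step hs.choose_spec

/-! ### Completeness -/

/-- Configurations without edges and call vertices in which the main task has state `run I O`
and there are `c o` tokens of each block `o`. -/
structure Tidy (N : PetriNet P) (G : CTG Unit (Option (Option P)) (SimState P N.bound))
    (I : P → Bool) (O : Option P → Fin (N.bound + 1)) (c : Option P → ℕ) : Prop where
  zero_mem : 0 ∈ G.verts
  st_zero : G.st 0 = run I O
  task : ∀ v ∈ G.verts, G.task v
  no_edge : ∀ a b, ¬ G.edge a b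
  other : ∀ v ∈ G.verts, v ≠ 0 → ∃ o, G.st v = tok o ∧ G.lab v = some o
  count : ∀ o, G.parikh (tok o) = c o

/-- Some reachable configuration is tidy with the given parameters. -/
def TidyReach (N : PetriNet P) (d : P → Bool) (I : P → Bool)
    (O : Option P → Fin (N.bound + 1)) (c : Option P → ℕ) : Prop :=
  ∃ G, (G, d) ∈ N.toQDAS.Reach ∧ Tidy N G I O c

variable {d I : P → Bool} {O : Option P → Fin (N.bound + 1)} {c : Option P → ℕ}

theorem Tidy.unblocked {G : CTG Unit (Option (Option P)) (SimState P N.bound)}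
    (h : Tidy N G I O c) {v : ℕ} (hv : v ∈ G.verts) : G.Unblocked v :=
  ⟨hv, h.no_edge v⟩

theorem Tidy.setSt_zero {G : CTG Unit (Option (Option P)) (SimState P N.bound)}
    (h : Tidy N G I O c) (I' : P → Bool) (O' : Option P → Fin (N.bound + 1)) :
    Tidy N (G.setSt 0 (run I' O')) I' O' c where
  zero_mem := h.zero_mem
  st_zero := by simp [CTG.setSt]
  task := h.task
  no_edge := h.no_edge
  other v hv h0 := by
    simpa [CTG.setSt, Function.update_of_ne h0] using h.other v hv h0
  count o := by
    have := G.parikh_setSt h.zero_mem (run I' O') (tok o)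
    simpa [h.st_zero, h.count o] using this

theorem tidyReach_init :
    TidyReach N (fun _ => false) (fun _ => false) (N.pending 1 N.m0) fun _ => 0 := by
  refine ⟨N.toQDAS.initCTG, Relation.ReflTransGen.refl, by simp [QDAS.initCTG], rfl, ?_, ?_, ?_, ?_⟩
  · simp [QDAS.initCTG]
  · simp [QDAS.initCTG, CTG.edge]
  · simp [QDAS.initCTG]
  · simp [QDAS.initCTG, CTG.parikh, toQDAS]

theorem TidyReach.start {t : (P → Bool) × (P → Bool)} (ht : t ∈ N.trans)
    (hd : ∀ p, t.1 p = true → d p = true)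
    (h : TidyReach N d (fun _ => false) (fun _ => 0) c) :
    TidyReach N d t.1 (N.pending 0 (out t)) c := by
  obtain ⟨G, hG, hT⟩ := h
  refine ⟨_, hG.tail ⟨_, QDAS.Step.guard (v := 0) (hT.task 0 hT.zero_mem)
    (hT.unblocked hT.zero_mem) ?_ (guardSat_inputGuard.mpr hd)⟩, hT.setSt_zero _ _⟩
  rw [hT.st_zero]
  exact SimRule.start t ht

theorem TidyReach.clear (p : P) (h : TidyReach N d I O c) :
    TidyReach N (Function.update d p false) (Function.update I p false) O c := by
  obtain ⟨G, hG, hT⟩ := h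
  refine ⟨_, hG.tail ⟨_, QDAS.Step.assign (v := 0) (hT.task 0 hT.zero_mem)
    (hT.unblocked hT.zero_mem) ?_⟩, hT.setSt_zero _ _⟩
  rw [hT.st_zero]
  exact SimRule.clear I O p

theorem TidyReach.emit {o : Option P} (ho : 0 < (O o : ℕ)) (h : TidyReach N d I O c) :
    TidyReach N d I (dec O o) (Function.update c o (c o + 1)) := by
  obtain ⟨G, hG, hT⟩ := h
  obtain ⟨v', hv'⟩ := G.verts.exists_notMem
  have hr : (G.st 0, QAct.dispatchA () (some o), run I (dec O o)) ∈ N.toQDAS.rules := by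
    rw [hT.st_zero]
    exact SimRule.emit I O o ho
  have hstep := QDAS.Step.dispatchA (d := d) (hT.task 0 hT.zero_mem)
    (hT.unblocked hT.zero_mem) hr hv'
  have hT' := hT.setSt_zero I (dec O o)
  have hv'' : v' ∉ (G.setSt 0 (run I (dec O o))).verts := hv'
  generalize G.setSt 0 (run I (dec O o)) = G' at hstep hT' hv''
  have hne : (0 : ℕ) ≠ v' := ne_of_mem_of_not_mem hT'.zero_mem hv''
  have hq : ∀ a b, ¬ (G'.enqueue (N.toQDAS.serial ()) () (some o)
      (N.toQDAS.init (some o)) v').edge a b := by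
    rintro a b ((h | ⟨-, hb, hnt, -⟩) | (h | ⟨h, -⟩))
    · exact hT'.no_edge a b (Or.inl h)
    · exact hnt (hT'.task b hb)
    · exact hT'.no_edge a b (Or.inr h)
    · exact h
  refine ⟨_, (hG.tail ⟨_, hstep⟩).tail ⟨_, QDAS.Step.schedDequeue (q := ()) (v := v')
    ⟨?_, ?_, ?_, fun b hb => hq v' b (Or.inl hb)⟩ (hq v')⟩, ?_, ?_, ?_, ?_, ?_, ?_⟩
  · exact Finset.mem_insert_self _ _
  · exact fun h => h.1 rfl
  · simp [CTG.enqueue]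
  · exact Finset.mem_insert_of_mem hT'.zero_mem
  · simpa [CTG.enqueue, CTG.dequeue, Function.update_of_ne hne] using hT'.st_zero
  · intro v hv
    by_cases h : v = v'
    · exact Or.inl h
    · exact Or.inr ⟨h, hT'.task v ((Finset.mem_insert.mp hv).resolve_left h)⟩
  · rintro a b (⟨h, -⟩ | (h | ⟨h, -⟩))
    · exact hq a b (Or.inl h)
    · exact hq a b (Or.inr h)
    · exact h
  · intro v hv h0
    by_cases h : v = v'
    · subst h
      exact ⟨o, by simp [CTG.enqueue, CTG.dequeue, toQDAS]⟩
    · simpa [CTG.enqueue, CTG.dequeue, Function.update_of_ne h] using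
        hT'.other v ((Finset.mem_insert.mp hv).resolve_left h) h0
  · intro o'
    rw [CTG.parikh_dequeue, CTG.parikh_enqueue _ hv'', hT'.count]
    by_cases h : o' = o
    · subst h
      simp [toQDAS]
    · simp [toQDAS, Function.update_of_ne h, Ne.symm h]

theorem TidyReach.consume {p : P} (hp : 0 < c (some p)) (h : TidyReach N d I O c) :
    TidyReach N (Function.update d p true) I O
      (Function.update c (some p) (c (some p) - 1)) := by
  obtain ⟨G, hG, hT⟩ := h
  obtain ⟨v, hv, hst⟩ := G.exists_of_parikh_pos ((hT.count (some p)).symm ▸ hp)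
  have h0 : v ≠ 0 := by
    rintro rfl
    simp [hT.st_zero] at hst
  obtain ⟨o, ho, hlab⟩ := hT.other v hv h0
  obtain rfl : o = some p := by simpa [hst] using ho.symm
  have hr : (G.st v, QAct.assign p true, fin (some p)) ∈ N.toQDAS.rules := by
    rw [hst]
    exact SimRule.consume p
  have hstep := QDAS.Step.assign (d := d) (hT.task v hv) (hT.unblocked hv) hr
  refine ⟨_, (hG.tail ⟨_, hstep⟩).tail ⟨_, QDAS.Step.schedErase (v := v)
    (hT.task v hv) ⟨hv, hT.no_edge v⟩ ?_⟩, ?_, ?_, ?_, ?_, ?_, ?_⟩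
  · simp [CTG.setSt, hlab, toQDAS]
  · exact Finset.mem_erase.mpr ⟨h0.symm, hT.zero_mem⟩
  · simpa [CTG.setSt, CTG.erase, Function.update_of_ne h0.symm] using hT.st_zero
  · exact fun u hu => hT.task u (Finset.mem_of_mem_erase hu)
  · rintro a b (⟨h, -⟩ | ⟨h, -⟩)
    · exact hT.no_edge a b (Or.inl h)
    · exact hT.no_edge a b (Or.inr h)
  · intro u hu hu0
    simpa [CTG.setSt, CTG.erase, Function.update_of_ne (Finset.ne_of_mem_erase hu)] using
      hT.other u (Finset.mem_of_mem_erase hu) hu0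
  · intro o'
    have h1 := (G.setSt v (fin (some p))).parikh_erase hv (tok o')
    have h2 := G.parikh_setSt hv (fin (some p)) (tok o')
    rw [hT.count, hst] at h2
    simp only [CTG.setSt, Function.update_self, reduceCtorEq, if_false, add_zero,
      tok.injEq] at h1 h2 ⊢
    by_cases h : o' = some p
    · subst h
      simp at h2 ⊢
      omega
    · simp [Ne.symm h] at h2
      rw [Function.update_of_ne h]
      omega

theorem TidyReach.clear_all (h : TidyReach N d I O c) :
    TidyReach N (fun _ => false) (fun _ => false) O c := by
  suffices H : ∀ s : Finset P, TidyReach N (fun p => if p ∈ s then false else d p)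
      (fun p => if p ∈ s then false else I p) O c by simpa using H Finset.univ
  intro s
  induction s using Finset.induction_on with
  | empty => simpa using h
  | insert a s _ ih =>
    have hupd : ∀ f : P → Bool, (fun p => if p ∈ insert a s then false else f p)
        = Function.update (fun p => if p ∈ s then false else f p) a false := by
      intro f
      funext p
      by_cases hp : p = a <;> simp [hp]
    rw [hupd, hupd]
    exact ih.clear a

theorem TidyReach.emit_all (h : TidyReach N d I O c) :
    TidyReach N d I (fun _ => 0) fun o => c o + O o := by
  induction hn : ∑ o, (O o : ℕ) generalizing O c with
  | zero =>
    have hO : ∀ o, O o = 0 := fun o =>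
      Fin.ext ((Finset.sum_eq_zero_iff.mp hn) o (Finset.mem_univ o))
    obtain rfl : O = fun _ => 0 := funext hO
    simpa using h
  | succ n ih =>
    obtain ⟨o, -, ho⟩ := Finset.exists_ne_zero_of_sum_ne_zero (hn.trans_ne n.succ_ne_zero)
    have ho' := Nat.pos_of_ne_zero ho
    have hrest : ∑ x ∈ Finset.univ.erase o, (dec O o x : ℕ)
        = ∑ x ∈ Finset.univ.erase o, (O x : ℕ) :=
      Finset.sum_congr rfl fun x hx => by
        rw [dec, Function.update_of_ne (Finset.ne_of_mem_erase hx)]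
    have hself : (dec O o o : ℕ) = O o - 1 := by simp [dec]
    have hsum : ∑ x, (dec O o x : ℕ) = n := by
      rw [← Finset.add_sum_erase _ _ (Finset.mem_univ o)] at hn ⊢
      rw [hrest, hself]
      omega
    have := ih (h.emit ho') hsum
    convert this using 2 with x
    by_cases hx : x = o
    · subst hx
      rw [hself, Function.update_self]
      omega
    · simp [dec, Function.update_of_ne hx]

theorem TidyReach.consume_all (e : P → ℕ) (he : ∀ p, e p ≤ c (some p))
    (h : TidyReach N d I O c) :
    TidyReach N (fun p => d p || decide (0 < e p)) I O
      fun o => c o - o.elim 0 e := by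
  induction hn : ∑ p, e p generalizing d c e with
  | zero =>
    have h0 : e = fun _ => 0 :=
      funext fun p => (Finset.sum_eq_zero_iff.mp hn) p (Finset.mem_univ p)
    subst h0
    convert h using 1
    · simp
    · funext o
      cases o <;> simp
  | succ n ih =>
    obtain ⟨p, -, hp⟩ := Finset.exists_ne_zero_of_sum_ne_zero (hn.trans_ne n.succ_ne_zero)
    have hp' := Nat.pos_of_ne_zero hp
    have hsum : ∑ x, Function.update e p (e p - 1) x = n := by
      rw [Finset.sum_update_of_mem (Finset.mem_univ p), Finset.sdiff_singleton_eq_erase]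
      rw [← Finset.add_sum_erase _ _ (Finset.mem_univ p)] at hn
      omega
    have := ih (Function.update e p (e p - 1)) (fun x => ?_)
      (h.consume (hp'.trans_le (he p))) hsum
    · convert this using 1
      · funext x
        by_cases hx : x = p
        · subst hx
          simp [hp']
        · simp [Function.update_of_ne hx]
      · funext o
        rcases o with _ | x
        · simp
        · by_cases hx : x = p
          · subst hx
            have := he x
            simp
            omega
          · simp [Function.update_of_ne, hx]
    · by_cases hx : x = p
      · subst hx
        have := he x
        simp
        omega
      · simpa [Function.update_of_ne, hx] using he x

theorem tidyReach_of_reach {m : P → ℕ} (h : m ∈ N.Reach) :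
    TidyReach N (fun _ => false) (fun _ => false) (fun _ => 0) fun o => o.elim 1 m := by
  induction h with
  | refl =>
    convert (tidyReach_init (N := N)).emit_all using 2 with o
    rw [pending_val N le_rfl N.m0_le_bound, zero_add]
  | @tail m m' _ hf ih =>
    obtain ⟨t, ht, hin, hout⟩ := hf
    have h1 := ih.consume_all (inp t) hin
    have h2 := h1.start ht fun p hp => by simp [inp, hp]
    convert h2.clear_all.emit_all using 2 with o
    rw [pending_val N zero_le_one (N.out_le_bound t)]
    cases o with
    | none => simp
    | some p => simpa using hout p

end PetriNet

/-- For every Petri net `N` there is a concurrent asynchronous QDAS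
`A_N` over the domain `{0,1}` (here `Bool`), with a single concurrent queue, a block
`bl p` for every place `p`, and two designated states `t1`, `t2` of two further blocks,
such that a marking `m` belongs to `Cover(N)` iff some reachable configuration `(G, d)`
of `A_N` encodes `m`, in the sense that `Parikh(G)(t1) = Parikh(G)(t2) = 1`,
`Parikh(G)(s0_(bl p)) = m p` for every place `p`, and `Parikh(G)(s) = 0` for every
state `s` of a block `bl p` other than its initial state. -/
theorem pn_cover_iff_conc_async_qdas_reach
    {P : Type} [Fintype P] (N : PetriNet P) :
    ∃ (Γ X S : Type) (_iΓ : Fintype Γ) (_iX : Fintype X) (_iS : Fintype S)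
      (A : QDAS Unit Γ X Bool S) (bl : P → Γ) (t1 t2 : S),
      (∀ q, ¬ A.serial q) ∧ A.Asynchronous ∧
      Function.Injective bl ∧ (∀ p, bl p ≠ A.main) ∧
      (∀ p, A.blockOf t1 ≠ bl p) ∧ (∀ p, A.blockOf t2 ≠ bl p) ∧
      A.blockOf t1 ≠ A.blockOf t2 ∧
      (∀ m : P → ℕ,
        m ∈ N.Cover ↔
          ∃ c ∈ A.Reach,
            c.1.parikh t1 = 1 ∧ c.1.parikh t2 = 1 ∧
            (∀ p, c.1.parikh (A.init (bl p)) = m p) ∧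
            (∀ (p : P) (s : S), A.blockOf s = bl p → s ≠ A.init (bl p) →
              c.1.parikh s = 0)) := by
  have hfin := SimState.finite (P := P) (B := N.bound)
  refine ⟨Option (Option P), P, SimState P N.bound, inferInstance, inferInstance,
    Fintype.ofFinite _, N.toQDAS, fun p => some (some p),
    SimState.run (fun _ => false) fun _ => 0, SimState.tok none, fun _ h => h,
    N.toQDAS_asynchronous, fun p q h => by simpa using h, fun p => Option.some_ne_none _,
    fun p => (Option.some_ne_none _).symm, fun p => by simp [PetriNet.toQDAS, SimState.block],
    by simp [PetriNet.toQDAS, SimState.block], fun m => ⟨?_, ?_⟩⟩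
  · rintro ⟨m', hm', hle⟩
    have h := (PetriNet.tidyReach_of_reach hm').consume_all (fun p => m' p - m p)
      fun p => Nat.sub_le _ _
    obtain ⟨G, hG, hT⟩ := h
    refine ⟨_, hG, ?_, ?_, fun p => ?_, fun p s hs hne => ?_⟩
    · refine Finset.card_eq_one.mpr ⟨0, Finset.ext fun v => ?_⟩
      rw [Finset.mem_filter, Finset.mem_singleton]
      refine ⟨fun ⟨hv, hst⟩ => ?_, ?_⟩
      · by_contra h0
        obtain ⟨o, ho, -⟩ := hT.other v hv h0
        rw [hst] at ho
        cases ho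
      · rintro rfl
        exact ⟨hT.zero_mem, hT.st_zero⟩
    · simpa using hT.count none
    · exact (hT.count (some p)).trans (Nat.sub_sub_self (hle p))
    · refine Nat.eq_zero_of_not_pos fun hpos => ?_
      obtain ⟨v, hv, rfl⟩ := G.exists_of_parikh_pos hpos
      by_cases h0 : v = 0
      · subst h0
        rw [hT.st_zero] at hs
        cases hs
      · obtain ⟨o, ho, -⟩ := hT.other v hv h0
        rw [ho] at hs hne
        obtain rfl : o = some p := Option.some.inj hs
        exact hne rfl
  · rintro ⟨⟨G, d⟩, hc, h1, -, hm, -⟩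
    have hinv := PetriNet.simInv_of_reach hc
    obtain ⟨I, O, h0, hst, hoth, m', hm', hle⟩ := hinv
    exact ⟨m', hm', fun p => (hm p).symm.le.trans
      (((Nat.le_add_right _ _).trans (Nat.le_add_right _ _)).trans (hle p))⟩
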